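/- arXiv:1702.02400 — 4 statements merged into one kernel-verified Lean document; each statement's English description precedes it below -/
import Mathlib

section
/- Let n ≥ 1, X ∈ Sp(ℂ^{2n}), s ∈ ℂ, v ∈ ℂ^{2n}, and let ρ(X,s,v) be the (2n+2)×(2n+2) complex matrix in block form (with blocks of sizes 1, 1, 2n) having rows (1, 0, 0), (−2s, 1, v̂ᵀ), (v, 0, X), where v̂ = XᵀΩ₀v. Then ρ(X,s,v) is symplectic with respect to Ω̂₀, i.e., ρ(X,s,v)ᵀ Ω̂₀ ρ(X,s,v) = Ω̂₀. -/
noncomputable section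

open Matrix

/-- Index type for `(2n+2) × (2n+2)` matrices, blocks of sizes 1, 1, 2n,
coordinates `(z⁰, w₀, z¹,…,zⁿ, w₁,…,wₙ)`. -/
abbrev Idx (n : ℕ) := (Unit ⊕ Unit) ⊕ (Fin n ⊕ Fin n)

/-- The matrix `Ω₀ = [[0, Iₙ], [−Iₙ, 0]]` of the standard symplectic form on `ℂ^{2n}`. -/
def Omega0 (n : ℕ) : Matrix (Fin n ⊕ Fin n) (Fin n ⊕ Fin n) ℂ :=
  Matrix.fromBlocks 0 1 (-1) 0

/-- The `2 × 2` matrix `[[0, 1], [−1, 0]]` on the `(z⁰, w₀)`-block. -/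
def J2 : Matrix (Unit ⊕ Unit) (Unit ⊕ Unit) ℂ :=
  Matrix.fromBlocks 0 1 (-1) 0

/-- The `(2n+2) × (2n+2)` block-diagonal matrix `Ω̂₀` with blocks `[[0,1],[−1,0]]` and
`Ω₀`, representing the standard symplectic form on `ℂ^{2n+2}`. -/
def OmegaHat (n : ℕ) : Matrix (Idx n) (Idx n) ℂ :=
  Matrix.fromBlocks J2 0 0 (Omega0 n)

/-- The `(2n+2) × (2n+2)` complex matrix `ρ(X,s,v)` in block form (blocks of
sizes 1, 1, 2n) with rows `(1, 0, 0)`, `(−2s, 1, v̂ᵀ)`, `(v, 0, X)`, where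
`v̂ = Xᵀ Ω₀ v`. -/
def rho {n : ℕ} (X : Matrix (Fin n ⊕ Fin n) (Fin n ⊕ Fin n) ℂ) (s : ℂ)
    (v : Fin n ⊕ Fin n → ℂ) : Matrix (Idx n) (Idx n) ℂ :=
  fun i j =>
    match i, j with
    | Sum.inl (Sum.inl _), Sum.inl (Sum.inl _) => 1
    | Sum.inl (Sum.inl _), Sum.inl (Sum.inr _) => 0
    | Sum.inl (Sum.inl _), Sum.inr _ => 0
    | Sum.inl (Sum.inr _), Sum.inl (Sum.inl _) => -2 * s
    | Sum.inl (Sum.inr _), Sum.inl (Sum.inr _) => 1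
    | Sum.inl (Sum.inr _), Sum.inr k => (Xᵀ *ᵥ (Omega0 n *ᵥ v)) k
    | Sum.inr k, Sum.inl (Sum.inl _) => v k
    | Sum.inr k, Sum.inl (Sum.inr _) => 0
    | Sum.inr k, Sum.inr l => X k l

theorem Omega0_transpose (n : ℕ) : (Omega0 n)ᵀ = -Omega0 n := by
  simp [Omega0, fromBlocks_transpose, fromBlocks_neg]

theorem dotProduct_Omega0_mulVec_comm {n : ℕ} (u w : Fin n ⊕ Fin n → ℂ) :
    u ⬝ᵥ Omega0 n *ᵥ w = -(w ⬝ᵥ Omega0 n *ᵥ u) := by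
  rw [dotProduct_mulVec, ← mulVec_transpose, Omega0_transpose, neg_mulVec, neg_dotProduct,
    dotProduct_comm]

theorem dotProduct_Omega0_mulVec_self {n : ℕ} (u : Fin n ⊕ Fin n → ℂ) :
    u ⬝ᵥ Omega0 n *ᵥ u = 0 :=
  self_eq_neg.mp (dotProduct_Omega0_mulVec_comm u u)

/-- The Gram matrix of the columns of `A` with respect to the form `Ω̂₀`, entrywise. -/
theorem transpose_mul_OmegaHat_mul_apply {n : ℕ} (A : Matrix (Idx n) (Idx n) ℂ) (i j : Idx n) :
    (Aᵀ * OmegaHat n * A) i j =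
      A (.inl (.inl ())) i * A (.inl (.inr ())) j - A (.inl (.inr ())) i * A (.inl (.inl ())) j +
        (fun k => A (.inr k) i) ⬝ᵥ Omega0 n *ᵥ fun k => A (.inr k) j := by
  have h : (Aᵀ * OmegaHat n * A) i j = Aᵀ i ⬝ᵥ OmegaHat n *ᵥ Aᵀ j := by
    rw [Matrix.mul_assoc]; rfl
  rw [h, OmegaHat, fromBlocks_mulVec]
  simp [dotProduct, J2, mulVec, Fintype.sum_sum_type, Function.comp_def]
  ring

/-- For `X ∈ Sp(ℂ^{2n})`, `s ∈ ℂ`, `v ∈ ℂ^{2n}`, the matrix `ρ(X,s,v)` is symplectic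
with respect to `Ω̂₀`, i.e. `ρ(X,s,v)ᵀ Ω̂₀ ρ(X,s,v) = Ω̂₀`. -/
theorem stmt1 {n : ℕ} (hn : 1 ≤ n)
    (X : Matrix (Fin n ⊕ Fin n) (Fin n ⊕ Fin n) ℂ) (s : ℂ) (v : Fin n ⊕ Fin n → ℂ)
    (hX : Xᵀ * Omega0 n * X = Omega0 n) :
    (rho X s v)ᵀ * OmegaHat n * rho X s v = OmegaHat n := by
  have hcol (k l) : (fun a => X a k) ⬝ᵥ Omega0 n *ᵥ (fun a => X a l) = Omega0 n k l := by
    conv_rhs => rw [← hX, Matrix.mul_assoc]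
    rfl
  have hhat (l) : (fun a => X a l) ⬝ᵥ Omega0 n *ᵥ v = (Xᵀ *ᵥ (Omega0 n *ᵥ v)) l := rfl
  ext i j
  rw [transpose_mul_OmegaHat_mul_apply]
  rcases i with (_ | _) | k <;> rcases j with (_ | _) | l
  · simp [rho, OmegaHat, J2, dotProduct_Omega0_mulVec_self]
  · simp [rho, OmegaHat, J2, ← Pi.zero_def]
  · simp [rho, OmegaHat, dotProduct_Omega0_mulVec_comm v, hhat]
  · simp [rho, OmegaHat, J2, ← Pi.zero_def]
  · simp [rho, OmegaHat, J2, ← Pi.zero_def]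
  · simp [rho, OmegaHat, ← Pi.zero_def]
  · simp [rho, OmegaHat, hhat]
  · simp [rho, OmegaHat, ← Pi.zero_def]
  · simp [rho, OmegaHat, hcol]
end
end

section
/- Let n ≥ 1, let O ⊆ ℂⁿ be open, let φ : O → ℂ^{2n} be holomorphic, and let f : O → ℂ be holomorphic satisfying df = −φ*η, i.e., for all p ∈ O and all u ∈ ℂⁿ, (Df)ₚ(u) = −Ω(φ(p), (Dφ)ₚ(u)). Let (X, s, v) ∈ Sp(ℂ^{2n}) × ℂ × ℂ^{2n} and define φ' : O → ℂ^{2n} by φ'(p) = Xφ(p) + v and f' : O → ℂ by f'(p) = f(p) + Ω(φ'(p), v) − 2s. Then df' = −(φ')*η, i.e., for all p ∈ O and u ∈ ℂⁿ, (Df')ₚ(u) = −Ω(φ'(p), (Dφ')ₚ(u)). -/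
noncomputable section

open Matrix

/-- The standard complex symplectic form `Ω(u,v) = uᵀ Ω₀ v` on `ℂ^{2n}`. -/
def Om {n : ℕ} (u v : Fin n ⊕ Fin n → ℂ) : ℂ := u ⬝ᵥ (Omega0 n *ᵥ v)

theorem Om_add_left {n : ℕ} (a b c : Fin n ⊕ Fin n → ℂ) : Om (a + b) c = Om a c + Om b c :=
  add_dotProduct _ _ _

/-- The form `Ω` is skew-symmetric. -/
theorem Om_swap {n : ℕ} (a b : Fin n ⊕ Fin n → ℂ) : Om b a = -Om a b := by
  have hT : (Omega0 n)ᵀ = -Omega0 n := by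
    simp [Omega0, fromBlocks_transpose, fromBlocks_neg]
  rw [Om, Om, dotProduct_mulVec, dotProduct_comm, ← mulVec_transpose, hT, neg_mulVec,
    dotProduct_neg]

/-- Symplectic matrices preserve `Ω`. -/
theorem Om_mulVec_mulVec {n : ℕ} {X : Matrix (Fin n ⊕ Fin n) (Fin n ⊕ Fin n) ℂ}
    (hX : Xᵀ * Omega0 n * X = Omega0 n) (a b : Fin n ⊕ Fin n → ℂ) :
    Om (X *ᵥ a) (X *ᵥ b) = Om a b := by
  rw [Om, Om, ← vecMul_transpose, ← dotProduct_mulVec, mulVec_mulVec, mulVec_mulVec,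
    hX]

theorem HasFDerivAt.matrix_mulVec {m n E : Type*} [Fintype m] [Fintype n]
    [NormedAddCommGroup E] [NormedSpace ℂ E] {φ : E → n → ℂ} {φ' : E →L[ℂ] (n → ℂ)} {p : E}
    (h : HasFDerivAt φ φ' p) (X : Matrix m n ℂ) :
    HasFDerivAt (fun q => X *ᵥ φ q) (X.mulVecLin.toContinuousLinearMap ∘L φ') p :=
  X.mulVecLin.toContinuousLinearMap.hasFDerivAt.comp p h

/-- The linear functional `Ω(·, v)`. -/
def OmLeft {n : ℕ} (v : Fin n ⊕ Fin n → ℂ) : (Fin n ⊕ Fin n → ℂ) →L[ℂ] ℂ :=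
  LinearMap.toContinuousLinearMap
    { toFun := fun a => Om a v
      map_add' := fun a b => Om_add_left a b v
      map_smul' := fun c a => smul_dotProduct c a _ }

/-- If `φ : O → ℂ^{2n}` is holomorphic, `f : O → ℂ` is a holomorphic Lagrangian
potential (`df = −φ*η`, with `η_q = Ω(q,·)`), and `(X,s,v) ∈ Sp(ℂ^{2n}) × ℂ × ℂ^{2n}`,
then `φ' = Xφ + v` and `f' = f + Ω(φ', v) − 2s` again satisfy `df' = −(φ')*η`. -/
theorem stmt6 {n : ℕ} (hn : 1 ≤ n)
    (O : Set (Fin n → ℂ)) (hO : IsOpen O)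
    (φ : (Fin n → ℂ) → (Fin n ⊕ Fin n → ℂ)) (f : (Fin n → ℂ) → ℂ)
    (hφ : DifferentiableOn ℂ φ O) (hf : DifferentiableOn ℂ f O)
    (hpot : ∀ p ∈ O, ∀ u : Fin n → ℂ,
      fderiv ℂ f p u = -Om (φ p) (fderiv ℂ φ p u))
    (X : Matrix (Fin n ⊕ Fin n) (Fin n ⊕ Fin n) ℂ)
    (hX : Xᵀ * Omega0 n * X = Omega0 n) (s : ℂ) (v : Fin n ⊕ Fin n → ℂ) :
    ∀ p ∈ O, ∀ u : Fin n → ℂ,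
      fderiv ℂ (fun q => f q + Om (X *ᵥ φ q + v) v - 2 * s) p u
        = -Om (X *ᵥ φ p + v) (fderiv ℂ (fun q => X *ᵥ φ q + v) p u) := by
  intro p hp u
  have hφp := (hφ.differentiableAt (hO.mem_nhds hp)).hasFDerivAt
  have hfp := (hf.differentiableAt (hO.mem_nhds hp)).hasFDerivAt
  have hφ' := (hφp.matrix_mulVec X).add_const v
  have hf' := (hfp.add ((OmLeft v).hasFDerivAt.comp p hφ')).sub_const (2 * s)
  have hfu : fderiv ℂ (fun q => f q + Om (X *ᵥ φ q + v) v - 2 * s) p u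
      = fderiv ℂ f p u + Om (X *ᵥ fderiv ℂ φ p u) v :=
    congrArg (fun L : (Fin n → ℂ) →L[ℂ] ℂ => L u) hf'.fderiv
  have hφu : fderiv ℂ (fun q => X *ᵥ φ q + v) p u = X *ᵥ fderiv ℂ φ p u :=
    congrArg (fun L : (Fin n → ℂ) →L[ℂ] (Fin n ⊕ Fin n → ℂ) => L u) hφ'.fderiv
  rw [hfu, hφu, hpot p hp u, Om_add_left, Om_mulVec_mulVec hX, Om_swap v]
  ring
end
end

section
/- Let n ≥ 1, let W ⊆ ℂ^{2n} be a complex linear subspace with W ∩ τ(W) = {0}, where τ denotes componentwise complex conjugation, let q ∈ ℝ^{2n} ⊆ ℂ^{2n} be a real vector, let c ∈ ℂ with c ∉ ℝ, and let α : W → ℂ be a ℂ-linear map. Define the complex subspace Ŵ ⊆ ℂ^{2n+2} = ℂ × ℂ × ℂ^{2n} as Ŵ = ℂ·(1, c, q) + {(0, α(v), v) : v ∈ W}. Then Ŵ ∩ τ̂(Ŵ) = {0}, where τ̂ denotes componentwise complex conjugation on ℂ^{2n+2}. -/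
noncomputable section

/-- Componentwise complex conjugation `τ` on `ℂ^{2n}`. -/
def tau {n : ℕ} (w : Fin n ⊕ Fin n → ℂ) : Fin n ⊕ Fin n → ℂ :=
  fun i => starRingEnd ℂ (w i)

/-- Componentwise complex conjugation `τ̂` on `ℂ^{2n+2} = ℂ × ℂ × ℂ^{2n}`. -/
def tauHat {n : ℕ} (u : ℂ × ℂ × (Fin n ⊕ Fin n → ℂ)) : ℂ × ℂ × (Fin n ⊕ Fin n → ℂ) :=
  (starRingEnd ℂ u.1, starRingEnd ℂ u.2.1, tau u.2.2)

/-- The complex subspace `Ŵ = ℂ·(1, c, q) + {(0, α(v), v) : v ∈ W} ⊆ ℂ × ℂ × ℂ^{2n}`. -/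
def What {n : ℕ} (W : Submodule ℂ (Fin n ⊕ Fin n → ℂ)) (q : Fin n ⊕ Fin n → ℝ) (c : ℂ)
    (α : W →ₗ[ℂ] ℂ) : Submodule ℂ (ℂ × ℂ × (Fin n ⊕ Fin n → ℂ)) :=
  Submodule.span ℂ {((1 : ℂ), c, fun i => (q i : ℂ))} ⊔
    LinearMap.range ((0 : W →ₗ[ℂ] ℂ).prod (α.prod W.subtype))

/-- Membership in `Ŵ` read off in coordinates. -/
theorem mem_What_iff {n : ℕ} {W : Submodule ℂ (Fin n ⊕ Fin n → ℂ)} {q : Fin n ⊕ Fin n → ℝ}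
    {c : ℂ} {α : W →ₗ[ℂ] ℂ} {u : ℂ × ℂ × (Fin n ⊕ Fin n → ℂ)} :
    u ∈ What W q c α ↔
      ∃ v : W, u.2.1 = u.1 * c + α v ∧ ∀ i, u.2.2 i = u.1 * q i + (v : Fin n ⊕ Fin n → ℂ) i := by
  simp only [What, Submodule.mem_sup, Submodule.mem_span_singleton, LinearMap.mem_range]
  constructor
  · rintro ⟨_, ⟨a, rfl⟩, _, ⟨v, rfl⟩, rfl⟩
    exact ⟨v, by simp, fun i => by simp⟩
  · rintro ⟨v, h₁, h₂⟩
    refine ⟨_, ⟨u.1, rfl⟩, _, ⟨v, rfl⟩, ?_⟩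
    refine Prod.ext (by simp) (Prod.ext (by simp [h₁]) (funext fun i => ?_))
    simp [h₂]

/-- Let `W ⊆ ℂ^{2n}` be a totally complex subspace (`W ∩ τ(W) = {0}`), `q` a real
vector, `c ∈ ℂ \ ℝ`, and `α : W → ℂ` a `ℂ`-linear map.  Then the subspace
`Ŵ = ℂ·(1, c, q) + {(0, α(v), v) : v ∈ W}` of `ℂ^{2n+2}` is also totally complex:
`Ŵ ∩ τ̂(Ŵ) = {0}`. -/
theorem stmt9 {n : ℕ} (hn : 1 ≤ n)
    (W : Submodule ℂ (Fin n ⊕ Fin n → ℂ))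
    (hW : ∀ w ∈ W, tau w ∈ W → w = 0)
    (q : Fin n ⊕ Fin n → ℝ) (c : ℂ) (hc : c ∉ Set.range (Complex.ofReal))
    (α : W →ₗ[ℂ] ℂ) :
    ∀ u ∈ What W q c α, tauHat u ∈ What W q c α → u = 0 := by
  intro u hu hu'
  obtain ⟨v, hv, hvi⟩ := mem_What_iff.1 hu
  obtain ⟨w, hw, hwi⟩ := mem_What_iff.1 hu'
  have tau_v : tau (v : Fin n ⊕ Fin n → ℂ) = w := by
    funext i
    have h := hwi i
    simp only [tauHat, tau, hvi, map_add, map_mul, Complex.conj_ofReal] at h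
    exact add_left_cancel h
  have v_zero : v = 0 := Subtype.ext (hW v v.2 (tau_v ▸ w.2))
  have w_zero : w = 0 := by
    apply Subtype.ext
    rw [← tau_v, v_zero]
    funext i
    simp [tau]
  have u_fst : u.1 = 0 := by
    by_contra h
    simp only [tauHat, hv, v_zero, w_zero, map_zero, add_zero, map_mul] at hw
    have conj_c := mul_left_cancel₀ ((map_ne_zero (starRingEnd ℂ)).2 h) hw
    obtain ⟨r, hr⟩ := Complex.conj_eq_iff_real.1 conj_c
    exact hc ⟨r, hr.symm⟩
  refine Prod.ext u_fst (Prod.ext ?_ (funext fun i => ?_))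
  · simp [hv, u_fst, v_zero]
  · simp [hvi, u_fst, v_zero]
end
end

section
/- Let M be a topological space, G a group, and F a presheaf of sets on M such that for every open U ⊆ M the set F(U) carries a G-action, the restriction maps F(U) → F(V) (for open V ⊆ U) are G-equivariant, and whenever F(U) is nonempty the G-action on F(U) is simply transitive (free and transitive). Let p ∈ M and let U be an open neighborhood of p with F(U) ≠ ∅. Then the canonical germ map F(U) → F_p from sections over U to the stalk of F at p is a bijection. -/
noncomputable section

open CategoryTheory TopologicalSpace Opposite

/-- Let `F` be a presheaf of sets on a topological space `M` such that each `F(U)`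
carries an action of a group `G`, the restriction maps are `G`-equivariant, and the
action on every nonempty `F(U)` is simply transitive.  Then for every point `p` and
every open neighborhood `U` of `p` with `F(U) ≠ ∅`, the germ map `F(U) → F_p` is a
bijection. -/
theorem stmt10 (M : TopCat.{0}) (G : Type) [Group G]
    (F : TopCat.Presheaf (Type 0) M)
    (a : ∀ U : (Opens (M : TopCat))ᵒᵖ, G → F.obj U → F.obj U)
    (h_one : ∀ U (s : F.obj U), a U 1 s = s)
    (h_mul : ∀ U (g g' : G) (s : F.obj U), a U (g * g') s = a U g (a U g' s))
    (h_equiv : ∀ (U V : (Opens (M : TopCat))ᵒᵖ) (i : U ⟶ V) (g : G) (s : F.obj U),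
      F.map i (a U g s) = a V g (F.map i s))
    (h_simptrans : ∀ U, Nonempty (F.obj U) →
      ∀ s t : F.obj U, ∃! g : G, a U g s = t)
    (p : M) (U : Opens (M : TopCat)) (hp : p ∈ U)
    (hne : Nonempty (F.obj (op U))) :
    Function.Bijective (F.germ U p hp) := by
  constructor
  · intro s t hst
    obtain ⟨W, _, i, j, hW⟩ := F.germ_eq p hp hp s t hst
    obtain rfl : i = j := Subsingleton.elim _ _
    obtain ⟨g, rfl, -⟩ := h_simptrans (op U) ⟨s⟩ s t
    have hg : a (op W) g (F.map i.op s) = F.map i.op s :=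
      (h_equiv _ _ i.op g s).symm.trans hW.symm
    have hg_one : g = 1 :=
      (h_simptrans (op W) ⟨F.map i.op s⟩ _ _).unique hg (h_one _ _)
    rw [hg_one, h_one]
  · intro t
    obtain ⟨V, hVU, hpV, s, rfl⟩ := F.exists_le_germ_eq t hp
    obtain ⟨s₀⟩ := hne
    let i : V ⟶ U := homOfLE hVU
    obtain ⟨g, hg, -⟩ := h_simptrans (op V) ⟨s⟩ (F.map i.op s₀) s
    refine ⟨a (op U) g s₀, ?_⟩
    rw [← hg, ← h_equiv]
    exact (F.germ_res_apply i p hpV _).symm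
end
end
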